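/- (Lemma 4; Lemma 7 of Ghosal and van der Vaart.) There exists λ₀ ∈ (0,1) such that for any two probability densities f₀ and f₁ (with respect to a common σ-finite dominating measure μ) and any λ ∈ (0, λ₀): (i) ∫ f₀ log(f₀/f₁) dμ ≤ d_H²(f₀,f₁) (1 + 2 log(1/λ)) + 2 ∫_{f₁/f₀ ≤ λ} f₀ log(f₀/f₁) dμ, and (ii) ∫ f₀ (log(f₀/f₁))² dμ ≤ d_H²(f₀,f₁) (12 + 2 log(1/λ))² + 8 ∫_{f₁/f₀ ≤ λ} f₀ (log(f₀/f₁))² dμ. -/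

import Mathlib

open MeasureTheory Real

noncomputable section

/-- Squared Hellinger distance between two densities with respect to `μ`. -/
def hellingerSq {Ω : Type*} [MeasurableSpace Ω] (μ : Measure Ω) (f₀ f₁ : Ω → ℝ) : ℝ :=
  ∫ x, (Real.sqrt (f₀ x) - Real.sqrt (f₁ x)) ^ 2 ∂μ

/-- `f` is a probability density with respect to `μ`. -/
def IsDensityWRT {Ω : Type*} [MeasurableSpace Ω] (μ : Measure Ω) (f : Ω → ℝ) : Prop :=
  Measurable f ∧ (∀ x, 0 ≤ f x) ∧ (∫ x, f x ∂μ) = 1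

theorem IsDensityWRT.integrable {Ω : Type*} [MeasurableSpace Ω] {μ : Measure Ω} {f : Ω → ℝ}
    (hf : IsDensityWRT μ f) : Integrable f μ := by
  by_contra h
  have := integral_undef h
  rw [hf.2.2] at this
  exact one_ne_zero this

theorem integrable_sq_sqrt_sub_sqrt {Ω : Type*} [MeasurableSpace Ω] {μ : Measure Ω}
    {f₀ f₁ : Ω → ℝ} (h₀ : IsDensityWRT μ f₀) (h₁ : IsDensityWRT μ f₁) :
    Integrable (fun x => (√(f₀ x) - √(f₁ x)) ^ 2) μ := by
  have hm : Measurable fun x => (√(f₀ x) - √(f₁ x)) ^ 2 :=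
    ((h₀.1.sqrt).sub h₁.1.sqrt).pow_const 2
  refine (h₀.integrable.add h₁.integrable).mono' hm.aestronglyMeasurable (ae_of_all _ fun x => ?_)
  rw [Real.norm_of_nonneg (sq_nonneg _), Pi.add_apply]
  have := mul_nonneg (Real.sqrt_nonneg (f₀ x)) (Real.sqrt_nonneg (f₁ x))
  nlinarith [Real.sq_sqrt (h₀.2.1 x), Real.sq_sqrt (h₁.2.1 x)]

theorem neg_log_le_one_sub_add_mul_sq {s L : ℝ} (hs : 0 < s) (hL : 4 ≤ L)
    (hsL : -2 * log s ≤ L) : -log s ≤ (1 - s) + L * (1 - s) ^ 2 := by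
  rcases le_total s (1 / 4) with h | h
  · have h1 : (1 / 2 : ℝ) ≤ (1 - s) ^ 2 := by nlinarith
    nlinarith [mul_le_mul_of_nonneg_left h1 (by linarith : 0 ≤ L)]
  · have h1 := Real.one_sub_inv_le_log_of_pos hs
    have h2 : s⁻¹ - 1 = (1 - s) + s⁻¹ * (1 - s) ^ 2 := by
      field_simp
      ring
    have h3 : s⁻¹ ≤ L := by
      refine le_trans ?_ hL
      rw [inv_le_comm₀ hs (by norm_num)]
      linarith
    nlinarith [mul_le_mul_of_nonneg_right h3 (sq_nonneg (1 - s))]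

theorem sq_two_mul_log_le {s L : ℝ} (hs : 0 < s) (hL : 0 ≤ L) (hsL : -2 * log s ≤ L) :
    (-2 * log s) ^ 2 ≤ (12 + 2 * L) ^ 2 * (1 - s) ^ 2 := by
  rw [← mul_pow, sq_le_sq, abs_mul (12 + 2 * L), abs_of_nonneg (by linarith : 0 ≤ 12 + 2 * L)]
  have hup := Real.log_le_sub_one_of_pos hs
  rcases le_total 1 s with h | h
  · have h0 := Real.log_nonneg h
    rw [abs_of_nonpos (by linarith), abs_of_nonpos (by linarith)]
    nlinarith
  · have h0 := Real.log_nonpos hs.le h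
    rw [abs_of_nonneg (by linarith), abs_of_nonneg (by linarith)]
    have h1 := Real.one_sub_inv_le_log_of_pos hs
    have h2 : -(s * log s) ≤ 1 - s := by
      have := mul_le_mul_of_nonneg_left h1 hs.le
      rw [mul_sub, mul_inv_cancel₀ hs.ne'] at this
      linarith
    nlinarith [mul_le_mul_of_nonneg_right hsL (by linarith : 0 ≤ 1 - s)]

theorem log_div_eq_neg_two_mul_log_sqrt_div {p q : ℝ} (hp : 0 < p) (hq : 0 < q) :
    log (p / q) = -2 * log (√q / √p) := by
  rw [Real.log_div hp.ne' hq.ne', Real.log_div (Real.sqrt_pos.2 hq).ne' (Real.sqrt_pos.2 hp).ne',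
    Real.log_sqrt hq.le, Real.log_sqrt hp.le]
  ring

theorem log_div_le_log_one_div {p q lam : ℝ} (hp : 0 < p) (hq : 0 < q) (hlam : 0 < lam)
    (h : lam < q / p) : log (p / q) ≤ log (1 / lam) := by
  refine Real.log_le_log (div_pos hp hq) ?_
  rw [← one_div_div]
  exact one_div_le_one_div_of_le hlam h.le

theorem log_div_nonneg_of_div_le {p q lam : ℝ} (hp : 0 < p) (hq : 0 ≤ q) (hlam : lam ≤ 1)
    (h : q / p ≤ lam) : 0 ≤ log (p / q) := by
  rcases hq.eq_or_lt with rfl | hq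
  · simp
  · refine Real.log_nonneg ((one_le_div hq).2 ?_)
    have := (div_le_one hp).1 (h.trans hlam)
    exact this

theorem mul_sq_one_sub_sqrt_div {p q : ℝ} (hp : 0 < p) :
    p * (1 - √q / √p) ^ 2 = (√p - √q) ^ 2 := by
  have h := (Real.sqrt_pos.2 hp).ne'
  nth_rewrite 1 [← Real.sq_sqrt hp.le]
  field_simp

theorem mul_log_div_le {p q lam : ℝ} (hp : 0 < p) (hq : 0 < q) (hlam : 0 < lam)
    (h : lam < q / p) (hL : 4 ≤ log (1 / lam)) :
    p * log (p / q) ≤ (√p - √q) ^ 2 * (1 + 2 * log (1 / lam)) + (p - q) := by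
  have hs := div_pos (Real.sqrt_pos.2 hq) (Real.sqrt_pos.2 hp)
  have hle := log_div_le_log_one_div hp hq hlam h
  rw [log_div_eq_neg_two_mul_log_sqrt_div hp hq] at hle ⊢
  have key := mul_le_mul_of_nonneg_left (neg_log_le_one_sub_add_mul_sq hs hL hle) hp.le
  have h1 := mul_sq_one_sub_sqrt_div (q := q) hp
  have h2 : p * (√q / √p) = √p * √q := by
    have := (Real.sqrt_pos.2 hp).ne'
    nth_rewrite 1 [← Real.sq_sqrt hp.le]
    field_simp
  have h3 : p * ((1 - √q / √p) + log (1 / lam) * (1 - √q / √p) ^ 2)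
      = p - √p * √q + log (1 / lam) * (√p - √q) ^ 2 := by
    rw [← h1, ← h2]
    ring
  rw [h3] at key
  linear_combination 2 * key - Real.sq_sqrt hp.le - Real.sq_sqrt hq.le

theorem mul_log_div_sq_le {p q lam : ℝ} (hp : 0 < p) (hq : 0 < q) (hlam : 0 < lam)
    (h : lam < q / p) (hL : 0 ≤ log (1 / lam)) :
    p * log (p / q) ^ 2 ≤ (√p - √q) ^ 2 * (12 + 2 * log (1 / lam)) ^ 2 := by
  have hs := div_pos (Real.sqrt_pos.2 hq) (Real.sqrt_pos.2 hp)
  have hle := log_div_le_log_one_div hp hq hlam h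
  rw [log_div_eq_neg_two_mul_log_sqrt_div hp hq] at hle ⊢
  have key := mul_le_mul_of_nonneg_left (sq_two_mul_log_le hs hL hle) hp.le
  rw [← mul_sq_one_sub_sqrt_div hp]
  linarith

theorem integral_le_hellingerSq_mul_add {Ω : Type*} [MeasurableSpace Ω] {μ : Measure Ω}
    {f₀ f₁ F g : Ω → ℝ} (h₀ : IsDensityWRT μ f₀) (h₁ : IsDensityWRT μ f₁) {A : Set Ω}
    (hA : MeasurableSet A) {c k : ℝ} (hc : 0 ≤ c) (hk : 1 ≤ k) (hF : ∀ x ∈ A, 0 ≤ F x)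
    (hg : Integrable g μ) (hg_zero : ∫ x, g x ∂μ = 0)
    (hgA : ∀ x ∈ A, 0 ≤ (√(f₀ x) - √(f₁ x)) ^ 2 * c + g x)
    (hle : ∀ x ∉ A, F x ≤ (√(f₀ x) - √(f₁ x)) ^ 2 * c + g x) :
    ∫ x, F x ∂μ ≤ hellingerSq μ f₀ f₁ * c + k * ∫ x in A, F x ∂μ := by
  by_cases hint : Integrable F μ
  · have hH := (integrable_sq_sqrt_sub_sqrt h₀ h₁).mul_const c
    have hHg : Integrable (fun x => (√(f₀ x) - √(f₁ x)) ^ 2 * c + g x) μ := hH.add hg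
    have hI := (hint.indicator hA).const_mul k
    calc ∫ x, F x ∂μ
        ≤ ∫ x, ((√(f₀ x) - √(f₁ x)) ^ 2 * c + g x) + k * A.indicator F x ∂μ := by
          refine integral_mono hint (hHg.add hI) fun x => ?_
          by_cases hx : x ∈ A
          · simp only [Set.indicator_of_mem hx]
            nlinarith [hF x hx, hgA x hx]
          · simpa only [Set.indicator_of_notMem hx, mul_zero, add_zero] using hle x hx
      _ = hellingerSq μ f₀ f₁ * c + k * ∫ x in A, F x ∂μ := by
          rw [integral_add hHg hI, integral_add hH hg, hg_zero, integral_mul_const,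
            integral_const_mul, integral_indicator hA, add_zero, hellingerSq]
  · rw [integral_undef hint]
    have h1 : 0 ≤ hellingerSq μ f₀ f₁ := integral_nonneg fun x => sq_nonneg _
    have h2 : 0 ≤ ∫ x in A, F x ∂μ := setIntegral_nonneg hA hF
    positivity

/-- Lemma 4; Lemma 7 of Ghosal and van der Vaart, 2007: Kullback–Leibler
divergence and its second moment are controlled by the squared Hellinger distance up to
logarithmic factors plus remainder terms over the region where `f₁/f₀` is small. -/
theorem kl_bounded_by_hellinger_with_remainder :
    ∃ lam₀ : ℝ, 0 < lam₀ ∧ lam₀ < 1 ∧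
      ∀ (Ω : Type) (_ : MeasurableSpace Ω) (μ : Measure Ω), SigmaFinite μ →
        ∀ f₀ f₁ : Ω → ℝ, IsDensityWRT μ f₀ → IsDensityWRT μ f₁ →
          ∀ lam : ℝ, 0 < lam → lam < lam₀ →
            ((∫ x, f₀ x * Real.log (f₀ x / f₁ x) ∂μ)
                ≤ hellingerSq μ f₀ f₁ * (1 + 2 * Real.log (1 / lam)) +
                  2 * ∫ x in {x | 0 < f₀ x ∧ f₁ x / f₀ x ≤ lam},
                        f₀ x * Real.log (f₀ x / f₁ x) ∂μ) ∧
            ((∫ x, f₀ x * Real.log (f₀ x / f₁ x) ^ 2 ∂μ)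
                ≤ hellingerSq μ f₀ f₁ * (12 + 2 * Real.log (1 / lam)) ^ 2 +
                  8 * ∫ x in {x | 0 < f₀ x ∧ f₁ x / f₀ x ≤ lam},
                        f₀ x * Real.log (f₀ x / f₁ x) ^ 2 ∂μ) := by
  refine ⟨Real.exp (-4), Real.exp_pos _, Real.exp_lt_one_iff.2 (by norm_num), ?_⟩
  intro Ω _ μ _ f₀ f₁ h₀ h₁ lam hlam hlam₀
  have hL : 4 ≤ Real.log (1 / lam) := by
    have := (Real.log_lt_iff_lt_exp hlam).2 hlam₀
    rw [one_div, Real.log_inv]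
    linarith
  have hlam1 : lam ≤ 1 := hlam₀.le.trans (Real.exp_lt_one_iff.2 (by norm_num)).le
  have hA : MeasurableSet {x | 0 < f₀ x ∧ f₁ x / f₀ x ≤ lam} :=
    (measurableSet_lt measurable_const h₀.1).inter
      (measurableSet_le (h₁.1.div h₀.1) measurable_const)
  have hpos : ∀ x, ¬(0 < f₀ x ∧ f₁ x / f₀ x ≤ lam) → 0 < f₀ x →
      0 < f₁ x ∧ lam < f₁ x / f₀ x := by
    intro x hx hp
    have hlt : lam < f₁ x / f₀ x := not_le.1 fun h => hx ⟨hp, h⟩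
    exact ⟨(div_pos_iff_of_pos_right hp).1 (hlam.trans hlt), hlt⟩
  constructor
  · refine integral_le_hellingerSq_mul_add (g := fun x => f₀ x - f₁ x) h₀ h₁ hA (by linarith)
      one_le_two ?_ (h₀.integrable.sub h₁.integrable) ?_ ?_ ?_
    · rintro x ⟨hp, hx⟩
      exact mul_nonneg hp.le (log_div_nonneg_of_div_le hp (h₁.2.1 x) hlam1 hx)
    · rw [integral_sub h₀.integrable h₁.integrable, h₀.2.2, h₁.2.2, sub_self]
    · rintro x ⟨hp, hx⟩
      have := (div_le_one hp).1 (hx.trans hlam1)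
      exact add_nonneg (mul_nonneg (sq_nonneg _) (by linarith)) (sub_nonneg.2 this)
    · intro x hx
      rcases (h₀.2.1 x).eq_or_lt with hp | hp
      · simp only [← hp, zero_mul, Real.sqrt_zero, zero_sub, neg_sq, Real.sq_sqrt (h₁.2.1 x)]
        nlinarith [h₁.2.1 x]
      · obtain ⟨hq, hlt⟩ := hpos x hx hp
        exact mul_log_div_le hp hq hlam hlt hL
  · refine integral_le_hellingerSq_mul_add (g := fun _ => 0) h₀ h₁ hA (sq_nonneg _)
      (by norm_num) ?_ (integrable_zero _ _ _) (integral_zero _ _) ?_ ?_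
    · rintro x ⟨hp, -⟩
      positivity
    · intro x _
      positivity
    · intro x hx
      rw [add_zero]
      rcases (h₀.2.1 x).eq_or_lt with hp | hp
      · rw [← hp, zero_mul]
        positivity
      · obtain ⟨hq, hlt⟩ := hpos x hx hp
        exact mul_log_div_sq_le hp hq hlam hlt (by linarith)
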